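/- arXiv:2212.10649 — 3 statements merged into one kernel-verified Lean document; each statement's English description precedes it below -/
import Mathlib

section
/- Let G=(N,E) be a DAG with two topological orderings O and Õ, and let p be a probability mass function on X_N. If for every s ∈ N the conditional independence {s} ⊥⊥ pr^O(s) | pa_G(s) holds with respect to p, then for every s ∈ N the conditional independence {s} ⊥⊥ pr^Õ(s) | pa_G(s) also holds with respect to p. -/
open Finset

/-! Basic graph-theoretic definitions for Bayesian networks. -/

/-- Two nodes are joined (adjacent) in the directed graph `E`. -/
def GJoined {V : Type*} (E : V → V → Prop) (a b : V) : Prop := E a b ∨ E b a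

/-- A directed graph (given by its edge relation) is a DAG iff it has no cycles:
no node can reach itself by a nonempty directed walk. -/
def IsDAG {V : Type*} (E : V → V → Prop) : Prop := ∀ s, ¬ Relation.TransGen E s s

/-- The set of parents of `s`. -/
def paG {V : Type*} (E : V → V → Prop) (s : V) : Set V := {t | E t s}

/-- The set of children of `s`. -/
def chG {V : Type*} (E : V → V → Prop) (s : V) : Set V := {t | E s t}

/-- The set of descendants of `s` (nodes reachable from `s` by a nonempty directed path). -/
def desG {V : Type*} (E : V → V → Prop) (s : V) : Set V := {t | Relation.TransGen E s t}

/-- A set of nodes is complete if all pairs of distinct elements are joined. -/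
def GComplete {V : Type*} (E : V → V → Prop) (S : Set V) : Prop :=
  ∀ a ∈ S, ∀ b ∈ S, a ≠ b → GJoined E a b

/-- A directed graph is perfect if the parent set of every node is complete. -/
def GPerfect {V : Type*} (E : V → V → Prop) : Prop := ∀ s, GComplete E (paG E s)

/-- `a` and `b` are joined in the moral graph `G^M` of `E`:
either joined in `E` or distinct common parents of some node. -/
def MoralEdge {V : Type*} (E : V → V → Prop) (a b : V) : Prop :=
  E a b ∨ E b a ∨ (a ≠ b ∧ ∃ s, E a s ∧ E b s)

/-- A topological ordering of a graph on a finite node set: an injective map into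
`{1, …, |N|}` (encoded as `Fin (card V)`) increasing along edges. -/
def IsTopo {V : Type*} [Fintype V] (E : V → V → Prop) (O : V → Fin (Fintype.card V)) : Prop :=
  Function.Injective O ∧ ∀ s t, E s t → O s < O t

/-! d-separation. -/

/-- `u` is a v-structure (collider) of the trail `l` in the graph `E`. -/
def VStruct {V : Type*} (E : V → V → Prop) (l : List V) (u : V) : Prop :=
  ∃ l₁ l₂ a b, l = l₁ ++ a :: u :: b :: l₂ ∧ E a u ∧ E b u

/-- `l` is a trail in the graph `E`: a nonempty sequence of distinct nodes consecutively joined. -/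
def IsTrail {V : Type*} (E : V → V → Prop) (l : List V) : Prop :=
  l ≠ [] ∧ l.Nodup ∧ l.Chain' (GJoined E)

/-- The trail `l` is blocked by `S`. -/
def BlockedBy {V : Type*} (E : V → V → Prop) (S : Set V) (l : List V) : Prop :=
  ∃ u ∈ l, (u ∈ S ∧ ¬ VStruct E l u) ∨
    (VStruct E l u ∧ u ∉ S ∧ ∀ t ∈ desG E u, t ∉ S)

/-- d-separation: every trail from a node of `A` to a node of `B` is blocked by `S`. -/
def DSep {V : Type*} (E : V → V → Prop) (A B S : Set V) : Prop :=
  ∀ (l : List V) (a b : V), IsTrail E l → l.head? = some a → l.getLast? = some b →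
    a ∈ A → b ∈ B → BlockedBy E S l

/-- The set of leaves (childless nodes), as a `Finset`. -/
def leavesF {V : Type*} [Fintype V] (E : V → V → Prop) [DecidableRel E] : Finset V :=
  Finset.univ.filter fun s => ∀ t, ¬ E s t

/-! Probability on graphs (finite state spaces, pmfs). -/

section Prob

variable {V : Type*} [Fintype V] [DecidableEq V]
variable (X : V → Type*) [∀ v, Fintype (X v)]

/-- `p` is a probability mass function on `X_N = ∏ v, X v`. -/
def IsPMF (p : (∀ v, X v) → ℝ) : Prop :=
  (∀ x, 0 ≤ p x) ∧ ∑ x, p x = 1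

/-- `k` is a kernel function for the node `s` w.r.t. the graph `E`: it is nonnegative,
depends on the configuration only through the parents of `s` in `E`, and is normalized. -/
def IsKernel (E : V → V → Prop) (s : V) (k : X s → (∀ v, X v) → ℝ) : Prop :=
  (∀ a x, 0 ≤ k a x) ∧
  (∀ a x y, (∀ t, E t s → x t = y t) → k a x = k a y) ∧
  (∀ x, ∑ a, k a x = 1)

/-- `p` factorizes over the graph `E`: it is a product of kernel functions, one per node. -/
def Factorizes (E : V → V → Prop) (p : (∀ v, X v) → ℝ) : Prop :=
  ∃ k : ∀ s, X s → (∀ v, X v) → ℝ,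
    (∀ s, IsKernel X E s (k s)) ∧ ∀ x, p x = ∏ s, k s (x s) x

variable [∀ v, DecidableEq (X v)]

/-- The marginal of `p` on the coordinates in `C`, evaluated at (the `C`-part of) `x`. -/
def marg (p : (∀ v, X v) → ℝ) (C : Finset V) (x : ∀ v, X v) : ℝ :=
  ∑ y, if ∀ v ∈ C, y v = x v then p y else 0

/-- Conditional independence `A ⟂⟂ B ∣ S` w.r.t. the pmf `p`. -/
def CondIndep (p : (∀ v, X v) → ℝ) (A B S : Finset V) : Prop :=
  ∀ x, 0 < marg X p S x →
    marg X p (A ∪ B ∪ S) x * marg X p S x = marg X p (A ∪ S) x * marg X p (B ∪ S) x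

/-- `q` is a conditional system for `N ∖ A` given `A`: a family of pmfs on `X_{N∖A}`,
one for every configuration on `A`.  Here `q x` encodes `q(x_{N∖A} ∣ x_A)`. -/
def IsCondSystem (A : Finset V) (q : (∀ v, X v) → ℝ) : Prop :=
  (∀ x, 0 ≤ q x) ∧ ∀ x : ∀ v, X v, (∑ y, if ∀ v ∈ A, y v = x v then q y else 0) = 1

/-- The conditional system `q` for `N ∖ A` given `A` factorizes over the graph `E`. -/
def CondFactorizes (E : V → V → Prop) (A : Finset V) (q : (∀ v, X v) → ℝ) : Prop :=
  ∃ k : ∀ s, X s → (∀ v, X v) → ℝ,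
    (∀ s ∉ A, IsKernel X E s (k s)) ∧ ∀ x, q x = ∏ s ∈ Finset.univ \ A, k s (x s) x

/-- The conditional system `q` for `N ∖ A` given `A` is a version of the conditional
distribution of the pmf `p`. -/
def IsVersionOf (A : Finset V) (q p : (∀ v, X v) → ℝ) : Prop :=
  ∀ x, p x = q x * marg X p A x

/-- `G'` (edges `E'`) satisfies Goal I for `G` (edges `E`): `roots(G') ⊇ leaves(G)` and for
every pmf factorizing over `G` there is a conditional system for `N ∖ leaves(G)` given
`leaves(G)` factorizing over `G'` which is a version of its conditional distribution. -/
def GoalI (E E' : V → V → Prop) [DecidableRel E] : Prop :=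
  (∀ s ∈ leavesF E, ∀ t, ¬ E' t s) ∧
  ∀ p : (∀ v, X v) → ℝ, IsPMF X p → Factorizes X E p →
    ∃ q, IsCondSystem X (leavesF E) q ∧ CondFactorizes X E' (leavesF E) q ∧
      IsVersionOf X (leavesF E) q p

/-- `G'` (edges `E'`) satisfies Goal II for `G` (edges `E`): `P^{G'} ⊇ P^G` and every parent
in `G'` of a leaf of `G` is itself a leaf of `G`. -/
def GoalII (E E' : V → V → Prop) : Prop :=
  (∀ p : (∀ v, X v) → ℝ, IsPMF X p → Factorizes X E p → Factorizes X E' p) ∧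
  ∀ s t, (∀ u, ¬ E s u) → E' t s → ∀ u, ¬ E t u

end Prob

section Marginals

variable {V : Type*} [Fintype V] [DecidableEq V] {X : V → Type*} [∀ v, Fintype (X v)]
  [∀ v, DecidableEq (X v)] {p : (∀ v, X v) → ℝ}

lemma marg_congr {C : Finset V} {x y : ∀ v, X v} (hxy : ∀ v ∈ C, x v = y v) :
    marg X p C x = marg X p C y := by
  unfold marg
  refine Finset.sum_congr rfl fun z _ => ?_
  have : (∀ v ∈ C, z v = x v) ↔ ∀ v ∈ C, z v = y v :=
    forall₂_congr fun v hv => by rw [hxy v hv]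
  simp only [this]

lemma marg_univ (x : ∀ v, X v) : marg X p Finset.univ x = p x := by
  simp [marg, ← funext_iff]

lemma marg_empty (hp : IsPMF X p) (x : ∀ v, X v) : marg X p ∅ x = 1 := by
  simpa [marg] using hp.2

lemma marg_nonneg (hp : IsPMF X p) (C : Finset V) (x : ∀ v, X v) : 0 ≤ marg X p C x :=
  Finset.sum_nonneg fun y _ => by
    split_ifs
    exacts [hp.1 y, le_rfl]

lemma marg_anti (hp : IsPMF X p) {C D : Finset V} (hCD : C ⊆ D) (x : ∀ v, X v) :
    marg X p D x ≤ marg X p C x := by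
  refine Finset.sum_le_sum fun y _ => ?_
  by_cases hD : ∀ v ∈ D, y v = x v
  · rw [if_pos hD, if_pos fun v hv => hD v (hCD hv)]
  · rw [if_neg hD]
    split_ifs
    exacts [hp.1 y, le_rfl]

lemma sum_marg_insert {A : Finset V} {s : V} (hs : s ∉ A) (x : ∀ v, X v) :
    ∑ a, marg X p (insert s A) (Function.update x s a) = marg X p A x := by
  unfold marg
  rw [Finset.sum_comm]
  refine Finset.sum_congr rfl fun y _ => ?_
  have key : ∀ a, (∀ v ∈ insert s A, y v = Function.update x s a v) ↔
      y s = a ∧ ∀ v ∈ A, y v = x v := fun a => by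
    rw [Finset.forall_mem_insert, Function.update_self]
    refine and_congr_right fun _ => forall₂_congr fun v hv => ?_
    rw [Function.update_of_ne (ne_of_mem_of_not_mem hv hs)]
  simp only [key, ite_and]
  simp

/-- The conditional pmf of the coordinate `s` given the coordinates in `S`, taken to be uniform
where the conditioning event is null. -/
noncomputable def condPMF (p : (∀ v, X v) → ℝ) (S : Finset V) (s : V) (x : ∀ v, X v) : ℝ :=
  if marg X p S x = 0 then (Fintype.card (X s) : ℝ)⁻¹ else marg X p (insert s S) x / marg X p S x

lemma condPMF_congr {S : Finset V} {s : V} {x y : ∀ v, X v} (hxy : ∀ v ∈ insert s S, x v = y v) :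
    condPMF p S s x = condPMF p S s y := by
  unfold condPMF
  rw [marg_congr hxy, marg_congr fun v hv => hxy v (Finset.mem_insert_of_mem hv)]

lemma sum_condPMF [∀ v, Nonempty (X v)] {S : Finset V} {s : V} (hs : s ∉ S) (x : ∀ v, X v) :
    ∑ a, condPMF p S s (Function.update x s a) = 1 := by
  have hS : ∀ a, marg X p S (Function.update x s a) = marg X p S x := fun a =>
    marg_congr fun v hv => Function.update_of_ne (ne_of_mem_of_not_mem hv hs) _ _
  simp only [condPMF, hS]
  split_ifs with h0
  · simp
  · rw [← Finset.sum_div, sum_marg_insert hs, div_self h0]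

lemma marg_insert_eq_mul_condPMF_iff (hp : IsPMF X p) {A S : Finset V} {s : V} (hSA : S ⊆ A) :
    (∀ x, marg X p (insert s A) x = condPMF p S s x * marg X p A x) ↔
      CondIndep X p {s} A S := by
  have hA : A ∪ S = A := Finset.union_eq_left.2 hSA
  have hsA : insert s A ∪ S = insert s A := by
    rw [Finset.insert_union, hA]
  simp only [CondIndep, ← Finset.insert_eq, hA, hsA]
  refine forall_congr' fun x => ?_
  rcases (marg_nonneg hp S x).eq_or_lt with h0 | hpos
  · have hA0 : marg X p A x = 0 :=
      le_antisymm (h0 ▸ marg_anti hp hSA x) (marg_nonneg hp A x)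
    have hsA0 : marg X p (insert s A) x = 0 :=
      le_antisymm (hA0 ▸ marg_anti hp (Finset.subset_insert s A) x) (marg_nonneg hp _ x)
    simp [hA0, hsA0, ← h0]
  · rw [condPMF, if_neg hpos.ne', div_mul_eq_mul_div, eq_div_iff hpos.ne']
    exact ⟨fun h _ => h, fun h => h hpos⟩

end Marginals

section Factorization

variable {V : Type*} [Fintype V] [DecidableEq V] {X : V → Type*} [∀ v, Fintype (X v)]
  [∀ v, DecidableEq (X v)] {p : (∀ v, X v) → ℝ} {E : V → V → Prop} [DecidableRel E]
  {O : V → Fin (Fintype.card V)}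

lemma eq_prod_condPMF_of_condIndep (hO : IsTopo E O) (hp : IsPMF X p)
    (h : ∀ s, CondIndep X p {s} (Finset.univ.filter fun t => O t < O s)
      (Finset.univ.filter fun t => E t s)) (x : ∀ v, X v) :
    p x = ∏ s, condPMF p (Finset.univ.filter fun t => E t s) s x := by
  suffices H : ∀ A : Finset V, (∀ s ∈ A, ∀ t, O t < O s → t ∈ A) →
      marg X p A x = ∏ s ∈ A, condPMF p (Finset.univ.filter fun t => E t s) s x by
    rw [← H Finset.univ fun _ _ t _ => Finset.mem_univ t, marg_univ]
  intro A
  induction A using Finset.induction_on_max_value O with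
  | empty => simp [marg_empty hp]
  | insert s A hs hmax ih =>
    intro hlow
    have hlt : ∀ t ∈ A, O t < O s := fun t ht =>
      (hmax t ht).lt_of_ne fun e => hs (hO.1 e ▸ ht)
    have hA : (Finset.univ.filter fun t => O t < O s) = A := by
      ext t
      simp only [Finset.mem_filter, Finset.mem_univ, true_and]
      refine ⟨fun ht => ?_, hlt t⟩
      exact Finset.mem_of_mem_insert_of_ne (hlow s (Finset.mem_insert_self s A) t ht)
        fun e => ht.ne (congrArg O e)
    have hpa : (Finset.univ.filter fun t => E t s) ⊆ A := fun t ht =>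
      hA ▸ Finset.mem_filter.2 ⟨Finset.mem_univ t, hO.2 t s (Finset.mem_filter.1 ht).2⟩
    have hs' := h s
    rw [hA] at hs'
    rw [(marg_insert_eq_mul_condPMF_iff hp hpa).2 hs' x, Finset.prod_insert hs, ih]
    exact fun u hu t ht => Finset.mem_of_mem_insert_of_ne
      (hlow u (Finset.mem_insert_of_mem hu) t ht) fun e => (e ▸ ht).not_gt (hlt u hu)

lemma marg_eq_prod_condPMF [∀ v, Nonempty (X v)] (hO : IsTopo E O)
    (h : ∀ x, p x = ∏ s, condPMF p (Finset.univ.filter fun t => E t s) s x)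
    {A : Finset V} (hA : ∀ s ∈ A, ∀ t, E t s → t ∈ A) (x : ∀ v, X v) :
    marg X p A x = ∏ s ∈ A, condPMF p (Finset.univ.filter fun t => E t s) s x := by
  suffices H : ∀ B : Finset V, (∀ s ∈ Bᶜ, ∀ t, E t s → t ∈ Bᶜ) → ∀ x,
      marg X p Bᶜ x = ∏ s ∈ Bᶜ, condPMF p (Finset.univ.filter fun t => E t s) s x by
    simpa using H Aᶜ (by simpa using hA) x
  clear hA x A
  intro B
  induction B using Finset.induction_on_min_value O with
  | empty => simpa [marg_univ] using h
  | insert s B hs hmin ih =>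
    intro hcl x
    have hins : insert s (insert s B)ᶜ = Bᶜ := by
      ext t
      by_cases e : t = s <;> simp [e, hs]
    have hsc : s ∉ (insert s B)ᶜ := by simp
    have hirr : s ∉ Finset.univ.filter fun t => E t s := fun hm =>
      (hO.2 s s (Finset.mem_filter.1 hm).2).false
    have hB : ∀ u ∈ Bᶜ, ∀ t, E t u → t ∈ Bᶜ := fun u hu t ht => by
      rw [Finset.mem_compl]
      intro htB
      rcases Finset.mem_insert.1 (hins.symm ▸ hu) with rfl | hu'
      · exact (hO.2 t u ht).not_ge (hmin t htB)
      · exact Finset.mem_compl.1 (hcl u hu' t ht) (Finset.mem_insert_of_mem htB)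
    have hprod : ∀ a, ∏ u ∈ (insert s B)ᶜ,
        condPMF p (Finset.univ.filter fun t => E t u) u (Function.update x s a) =
        ∏ u ∈ (insert s B)ᶜ, condPMF p (Finset.univ.filter fun t => E t u) u x := fun a =>
      Finset.prod_congr rfl fun u hu => condPMF_congr fun v hv =>
        Function.update_of_ne (fun e => by
          subst e
          rcases Finset.mem_insert.1 hv with rfl | hv
          · exact hsc hu
          · exact hsc (hcl u hu v (Finset.mem_filter.1 hv).2)) _ _
    rw [← sum_marg_insert hsc, hins]
    simp only [ih hB]
    rw [← hins]
    simp only [Finset.prod_insert hsc, hprod]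
    rw [← Finset.sum_mul, sum_condPMF hirr, one_mul]

end Factorization

/-- local Markov property w.r.t. predecessors does not depend on the choice
of topological ordering. -/
theorem stmt1 {V : Type*} [Fintype V] [DecidableEq V] [Nonempty V]
    (X : V → Type*) [∀ v, Fintype (X v)] [∀ v, Nonempty (X v)] [∀ v, DecidableEq (X v)]
    (E : V → V → Prop) [DecidableRel E] (hE : IsDAG E)
    (O O' : V → Fin (Fintype.card V)) (hO : IsTopo E O) (hO' : IsTopo E O')
    (p : (∀ v, X v) → ℝ) (hp : IsPMF X p)
    (h : ∀ s, CondIndep X p {s} (Finset.univ.filter fun t => O t < O s)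
      (Finset.univ.filter fun t => E t s)) :
    ∀ s, CondIndep X p {s} (Finset.univ.filter fun t => O' t < O' s)
      (Finset.univ.filter fun t => E t s) := by
  intro s
  have hpa : (Finset.univ.filter fun t => E t s) ⊆ Finset.univ.filter fun t => O' t < O' s :=
    Finset.monotone_filter_right _ fun t _ => hO'.2 t s
  have hfac := eq_prod_condPMF_of_condIndep hO hp h
  rw [← marg_insert_eq_mul_condPMF_iff hp hpa]
  intro x
  have hlow : ∀ u ∈ Finset.univ.filter fun t => O' t < O' s, ∀ t, E t u →
      t ∈ Finset.univ.filter fun t => O' t < O' s := by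
    simpa using fun u hu t ht => (hO'.2 t u ht).trans hu
  rw [marg_eq_prod_condPMF hO' hfac hlow, marg_eq_prod_condPMF hO' hfac,
    Finset.prod_insert (by simp)]
  intro u hu t ht
  rcases Finset.mem_insert.1 hu with rfl | hu
  · exact Finset.mem_insert_of_mem (hpa (by simpa using ht))
  · exact Finset.mem_insert_of_mem (hlow u hu t ht)
end

section
/- Let G=(N,E) be a DAG and let G'=(N,E') be a DAG that satisfies Goal II for G. Then the graph G̃'=(N, E' ∖ E_leaves), where E_leaves={(s,t)∈E': s,t ∈ leaves(G)}, satisfies Goal I for G. -/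
open Finset

/-- A nonempty set of nodes of a finite DAG contains a node without children in that set. -/
theorem IsDAG.exists_sink {V : Type*} [Finite V] {E : V → V → Prop} (hE : IsDAG E)
    {B : Finset V} (hB : B.Nonempty) : ∃ s ∈ B, ∀ t ∈ B, ¬ E s t := by
  let r : V → V → Prop := fun a b => Relation.TransGen E b a
  have : IsTrans V r := ⟨fun _ _ _ hab hbc => hbc.trans hab⟩
  have : Std.Irrefl r := ⟨hE⟩
  obtain ⟨s, hs, hmin⟩ := (Finite.wellFounded_of_trans_of_irrefl r).has_min (B : Set V) hB
  exact ⟨s, hs, fun t ht hst => hmin t ht (.single hst)⟩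

/-- A sum over the configurations that agree with `x` off `B` can be carried out by first
summing over the coordinate `s ∈ B`. -/
theorem sum_agree_off_eq_sum_update {V : Type*} [Fintype V] [DecidableEq V]
    {X : V → Type*} [∀ v, Fintype (X v)] [∀ v, DecidableEq (X v)]
    {B : Finset V} {s : V} (hs : s ∈ B) (x : ∀ v, X v) (F : (∀ v, X v) → ℝ) :
    (∑ y with ∀ v ∉ B, y v = x v, F y) =
      ∑ z with ∀ v ∉ B.erase s, z v = x v, ∑ a, F (Function.update z s a) := by
  rw [← Finset.sum_product']
  refine Finset.sum_bij' (fun y _ => (Function.update y s (x s), y s))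
    (fun w _ => Function.update w.1 s w.2) ?_ ?_ ?_ ?_ ?_
  · intro y hy
    simp only [mem_filter, mem_univ, true_and, mem_product, and_true] at hy ⊢
    intro v hv
    by_cases hvs : v = s
    · subst hvs; simp
    · rw [Function.update_of_ne hvs]
      exact hy v fun h => hv (Finset.mem_erase.2 ⟨hvs, h⟩)
  · rintro ⟨z, a⟩ hz
    simp only [mem_filter, mem_univ, true_and, mem_product, and_true] at hz ⊢
    intro v hv
    rw [Function.update_of_ne (show v ≠ s by rintro rfl; exact hv hs)]
    exact hz v fun h => hv (Finset.mem_of_mem_erase h)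
  · intro y _
    simp
  · rintro ⟨z, a⟩ hz
    simp only [mem_filter, mem_univ, true_and, mem_product, and_true] at hz
    simp [← hz s (Finset.notMem_erase s B)]
  · intro y _
    simp

/-- With the coordinates off `B` held fixed, the product of the kernels of the nodes of `B`
sums to one. -/
theorem IsDAG.sum_prod_kernel_eq_one {V : Type*} [Fintype V] [DecidableEq V]
    {X : V → Type*} [∀ v, Fintype (X v)] [∀ v, DecidableEq (X v)]
    {E : V → V → Prop} (hE : IsDAG E) {k : ∀ s, X s → (∀ v, X v) → ℝ}
    (B : Finset V) (hk : ∀ s ∈ B, IsKernel X E s (k s)) (x : ∀ v, X v) :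
    (∑ y with ∀ v ∉ B, y v = x v, ∏ s ∈ B, k s (y s) y) = 1 := by
  induction B using Finset.strongInduction with
  | H B ih =>
    rcases B.eq_empty_or_nonempty with rfl | hB
    · simp [← funext_iff, Finset.filter_eq']
    · obtain ⟨s, hs, hsink⟩ := hE.exists_sink hB
      rw [sum_agree_off_eq_sum_update hs,
        ← ih (B.erase s) (Finset.erase_ssubset hs) fun t ht => hk t (Finset.mem_of_mem_erase ht)]
      refine Finset.sum_congr rfl fun z _ => ?_
      have key : ∀ a, ∏ t ∈ B, k t (Function.update z s a t) (Function.update z s a) =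
          k s a z * ∏ t ∈ B.erase s, k t (z t) z := by
        intro a
        rw [← Finset.mul_prod_erase B _ hs]
        have hupd : ∀ t ∈ B, ∀ b, k t b (Function.update z s a) = k t b z := fun t ht b =>
          (hk t ht).2.1 b _ _ fun u hu =>
            Function.update_of_ne (show u ≠ s by rintro rfl; exact hsink t ht hu) _ _
        congr 1
        · rw [hupd s hs, Function.update_self]
        · refine Finset.prod_congr rfl fun t ht => ?_
          rw [hupd t (Finset.mem_of_mem_erase ht),
            Function.update_of_ne (Finset.ne_of_mem_erase ht)]
      simp only [key]
      rw [← Finset.sum_mul, (hk s hs).2.2 z, one_mul]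

/-- if `G'` satisfies Goal II for `G`, then `G̃' = (N, E' ∖ E_leaves)`
(removing the edges of `G'` between leaves of `G`) satisfies Goal I for `G`. -/
theorem stmt3 {V : Type*} [Fintype V] [DecidableEq V] [Nonempty V]
    (X : V → Type*) [∀ v, Fintype (X v)] [∀ v, Nonempty (X v)] [∀ v, DecidableEq (X v)]
    (E E' : V → V → Prop) [DecidableRel E] (hE : IsDAG E) (hE' : IsDAG E')
    (hGoal : GoalII X E E') :
    GoalI X E (fun s t => E' s t ∧ ¬ ((∀ u, ¬ E s u) ∧ (∀ u, ¬ E t u))) := by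
  have hmem : ∀ s, s ∈ leavesF E ↔ ∀ u, ¬ E s u := by simp [leavesF]
  refine ⟨fun s hs t ht => ht.2 ⟨hGoal.2 s t ((hmem s).1 hs) ht.1, (hmem s).1 hs⟩, ?_⟩
  intro p hp hpE
  obtain ⟨k, hk, hpk⟩ := hGoal.1 p hp hpE
  have hsum : ∀ x : ∀ v, X v, (∑ y, if ∀ v ∈ leavesF E, y v = x v then
      ∏ s ∈ univ \ leavesF E, k s (y s) y else 0) = 1 := by
    intro x
    rw [← Finset.sum_filter,
      ← hE'.sum_prod_kernel_eq_one (univ \ leavesF E) (fun s _ => hk s) x]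
    simp
  refine ⟨fun x => ∏ s ∈ univ \ leavesF E, k s (x s) x,
    ⟨fun x => Finset.prod_nonneg fun s _ => (hk s).1 _ _, hsum⟩,
    ⟨k, fun s hs => ⟨(hk s).1, fun a x y hxy => ?_, (hk s).2.2⟩, fun x => rfl⟩, fun x => ?_⟩
  · exact (hk s).2.1 a x y fun t ht => hxy t ⟨ht, fun h => hs ((hmem s).2 h.2)⟩
  · have hsplit : ∀ y, p y = (∏ s ∈ univ \ leavesF E, k s (y s) y) *
        ∏ s ∈ leavesF E, k s (y s) y := fun y => by
      rw [hpk, Finset.prod_sdiff (Finset.subset_univ _)]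
    have hmarg : marg X p (leavesF E) x = ∏ s ∈ leavesF E, k s (x s) x := by
      rw [← one_mul (∏ s ∈ leavesF E, k s (x s) x), ← hsum x, Finset.sum_mul, marg]
      refine Finset.sum_congr rfl fun y _ => ?_
      split_ifs with hy
      · rw [hsplit]
        congr 1
        refine Finset.prod_congr rfl fun s hs => ?_
        rw [hy s hs]
        exact (hk s).2.1 _ _ _ fun t ht =>
          hy t ((hmem t).2 (hGoal.2 s t ((hmem s).1 hs) ht))
      · rw [zero_mul]
    rw [hmarg]
    exact hsplit x
end

section
/- Let G=(N,E) be a DAG and A ⊆ N such that every parent in G of a node of A lies in A, and let H=(N, E ∖ E_A) where E_A={(s,t)∈E: s,t∈A}. If a probability mass function p on X_N factorizes over G, then there exists a conditional system for N∖A given A that factorizes over H and is a version of the conditional distribution of p. -/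
open Finset

/-- An ancestral set of nodes of a finite DAG that misses some node also misses a node all of
whose parents it contains. -/
lemma IsDAG.exists_notMem_parents_mem {V : Type*} [Finite V] {E : V → V → Prop} (hE : IsDAG E)
    {A : Finset V} (hne : ∃ s, s ∉ A) : ∃ s ∉ A, ∀ t, E t s → t ∈ A := by
  have : Std.Irrefl (Relation.TransGen E) := ⟨hE⟩
  have hwf : WellFounded (Relation.TransGen E) := Finite.wellFounded_of_trans_of_irrefl _
  obtain ⟨s, hs, hmin⟩ := hwf.has_min {s | s ∉ A} hne
  exact ⟨s, hs, fun t ht => by_contra fun h => hmin t h (.single ht)⟩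

section Prob

variable {V : Type*} [Fintype V] [DecidableEq V]
variable (X : V → Type*) [∀ v, Fintype (X v)] [∀ v, DecidableEq (X v)]

/-- The sum of `f` over the configurations that agree with `x` on `A` can be split according to
the value of a further coordinate `s`. -/
lemma marg_eq_sum_marg_insert (f : (∀ v, X v) → ℝ) {A : Finset V} {s : V} (hs : s ∉ A)
    (x : ∀ v, X v) :
    marg X f A x = ∑ a, marg X f (insert s A) (Function.update x s a) := by
  unfold marg
  rw [Finset.sum_comm]
  refine Finset.sum_congr rfl fun y _ => ?_
  have hiff : ∀ a, (∀ v ∈ insert s A, y v = Function.update x s a v) ↔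
      y s = a ∧ ∀ v ∈ A, y v = x v := by
    intro a
    rw [Finset.forall_mem_insert, Function.update_self]
    refine and_congr_right fun _ => forall₂_congr fun v hv => ?_
    rw [Function.update_of_ne (ne_of_mem_of_not_mem hv hs)]
  simp only [hiff, ite_and]
  simp

/-- A factor that is constant on the configurations agreeing with `x` on `A` can be pulled out of
the marginal on `A`. -/
lemma marg_mul_left {f g : (∀ v, X v) → ℝ} {A : Finset V} {x : ∀ v, X v}
    (hg : ∀ y : ∀ v, X v, (∀ v ∈ A, y v = x v) → g y = g x) :
    marg X (fun y => g y * f y) A x = g x * marg X f A x := by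
  unfold marg
  rw [Finset.mul_sum]
  refine Finset.sum_congr rfl fun y _ => ?_
  split_ifs with h
  · simp only [hg y h]
  · rw [mul_zero]

/-- The product of the kernels of the nodes outside an ancestral set `A` sums to one over the
configurations with prescribed values on `A`. -/
lemma marg_prod_kernel_eq_one {E : V → V → Prop} (hE : IsDAG E)
    {k : ∀ s, X s → (∀ v, X v) → ℝ} (hk : ∀ s, IsKernel X E s (k s))
    (A : Finset V) (hA : ∀ s ∈ A, ∀ t, E t s → t ∈ A) (x : ∀ v, X v) :
    marg X (fun y => ∏ s ∈ Finset.univ \ A, k s (y s) y) A x = 1 := by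
  by_cases hne : ∃ s, s ∉ A
  · obtain ⟨s, hs, hpa⟩ := hE.exists_notMem_parents_mem hne
    have hA' : ∀ r ∈ insert s A, ∀ t, E t r → t ∈ insert s A := by
      intro r hr t ht
      rcases Finset.mem_insert.1 hr with rfl | hr
      · exact Finset.mem_insert_of_mem (hpa t ht)
      · exact Finset.mem_insert_of_mem (hA r hr t ht)
    have hprod : (fun y : ∀ v, X v => ∏ r ∈ Finset.univ \ A, k r (y r) y) =
        fun y => k s (y s) y * ∏ r ∈ Finset.univ \ insert s A, k r (y r) y := by
      funext y
      rw [← Finset.mul_prod_erase _ _ (Finset.mem_sdiff.2 ⟨Finset.mem_univ s, hs⟩),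
        Finset.sdiff_insert]
    rw [hprod, marg_eq_sum_marg_insert X _ hs, ← (hk s).2.2 x]
    refine Finset.sum_congr rfl fun a _ => ?_
    rw [marg_mul_left, marg_prod_kernel_eq_one hE hk (insert s A) hA', mul_one,
      Function.update_self]
    · exact (hk s).2.1 a _ _ fun t ht =>
        Function.update_of_ne (ne_of_mem_of_not_mem (hpa t ht) hs) _ _
    · intro y hy
      rw [hy s (Finset.mem_insert_self s A)]
      exact (hk s).2.1 _ _ _ fun t ht => hy t (Finset.mem_insert_of_mem (hpa t ht))
  · push Not at hne
    obtain rfl : A = Finset.univ := Finset.eq_univ_of_forall hne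
    simp [marg, ← funext_iff]
termination_by (Finset.univ \ A).card
decreasing_by
  rw [Finset.sdiff_insert]
  exact Finset.card_erase_lt_of_mem (Finset.mem_sdiff.2 ⟨Finset.mem_univ s, hs⟩)

end Prob

/-- if the parents in `G` of nodes of `A` lie in `A` and `p` factorizes over
`G`, then there is a conditional system for `N ∖ A` given `A` that factorizes over
`H = (N, E ∖ E_A)` (removing the edges between nodes of `A`) and is a version of the
conditional distribution of `p`. -/
theorem stmt5 {V : Type*} [Fintype V] [DecidableEq V] [Nonempty V]
    (X : V → Type*) [∀ v, Fintype (X v)] [∀ v, Nonempty (X v)] [∀ v, DecidableEq (X v)]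
    (E : V → V → Prop) (hE : IsDAG E)
    (A : Finset V) (hA : ∀ s ∈ A, ∀ t, E t s → t ∈ A)
    (p : (∀ v, X v) → ℝ) (hp : IsPMF X p) (hfac : Factorizes X E p) :
    ∃ q, IsCondSystem X A q ∧
      CondFactorizes X (fun s t => E s t ∧ ¬ (s ∈ A ∧ t ∈ A)) A q ∧
      IsVersionOf X A q p := by
  obtain ⟨k, hk, hpk⟩ := hfac
  have hsum := marg_prod_kernel_eq_one X hE hk A hA
  refine ⟨fun x => ∏ s ∈ Finset.univ \ A, k s (x s) x,
    ⟨fun x => Finset.prod_nonneg fun s _ => (hk s).1 _ _, hsum⟩,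
    ⟨k, fun s hs => ⟨(hk s).1, fun a x y h => (hk s).2.1 a x y fun t ht =>
      h t ⟨ht, fun hts => hs hts.2⟩, (hk s).2.2⟩, fun _ => rfl⟩, fun x => ?_⟩
  have hsplit : p = fun y => (∏ s ∈ A, k s (y s) y) * ∏ s ∈ Finset.univ \ A, k s (y s) y := by
    funext y
    rw [hpk, mul_comm, Finset.prod_sdiff (Finset.subset_univ A)]
  have hmarg : marg X p A x = ∏ s ∈ A, k s (x s) x := by
    rw [hsplit, marg_mul_left, hsum, mul_one]
    intro y hy
    refine Finset.prod_congr rfl fun s hs => ?_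
    rw [hy s hs]
    exact (hk s).2.1 _ _ _ fun t ht => hy t (hA s hs t ht)
  rw [hmarg, hsplit, mul_comm]
end
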